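/- arXiv:2307.01399 — 2 statements merged into one kernel-verified Lean document; each statement's English description precedes it below -/
import Mathlib

section
/- Let f be a probability density on ℝ and f_{μ,σ}(y) = (1/σ) f((y−μ)/σ) its location-scale family. Assume the family is Hellinger differentiable at (μ,σ) = (0,1), i.e., the map (μ,σ) ↦ √(f_{μ,σ}) ∈ L²(ℝ) has a derivative vector (ξ̇_μ, ξ̇_σ) of square-integrable functions at (0,1) with remainder of order o(√(μ² + (σ−1)²)), and assume the two components ξ̇_μ, ξ̇_σ are not linearly dependent. Then for any J > 0 and any σ̄ > 1 with σ̲ = σ̄^{−1}, there exists a constant C̲ > 0 (depending on f, J, σ̄) such that d²_H(f_{μ₁,σ₁}, f_{μ₂,σ₂}) ≥ C̲ (μ₁ − μ₂)² for all μ₁, μ₂ ∈ [−J, J] and all σ₁, σ₂ ∈ [σ̲, σ̄]. -/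
open MeasureTheory Filter Asymptotics Topology

/-- The location-scale family `f_{η,σ}(y) = (1/σ) f((y-η)/σ)`. -/
noncomputable def locScale (f : ℝ → ℝ) (η σ : ℝ) : ℝ → ℝ := fun y => σ⁻¹ * f ((y - η) / σ)

/-- The `L²(ℝ)` norm of a function (with respect to Lebesgue measure). -/
noncomputable def l2norm (r : ℝ → ℝ) : ℝ := Real.sqrt (∫ y, (r y) ^ 2)

/-- The squared Hellinger distance `d²_H(q₁,q₂) = ∫ (√q₁ - √q₂)² dy`. -/
noncomputable def hellingerSq (q₁ q₂ : ℝ → ℝ) : ℝ :=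
  ∫ y, (Real.sqrt (q₁ y) - Real.sqrt (q₂ y)) ^ 2

/-- Hellinger differentiability at `(η,σ) = (0,1)` of the location-scale family of `f`,
with derivative vector `(ξη, ξσ)` of square-integrable functions and `L²` remainder of
order `o(|θ - (0,1)|)`. -/
def HellingerDiffAt (f : ℝ → ℝ) (ξη ξσ : ℝ → ℝ) : Prop :=
  Integrable (fun y => (ξη y) ^ 2) ∧ Integrable (fun y => (ξσ y) ^ 2) ∧
  (fun θ : ℝ × ℝ => l2norm (fun y =>
      Real.sqrt (locScale f θ.1 θ.2 y) - Real.sqrt (f y) - θ.1 * ξη y - (θ.2 - 1) * ξσ y))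
    =o[𝓝 ((0 : ℝ), (1 : ℝ))] (fun θ : ℝ × ℝ => ‖θ - ((0 : ℝ), (1 : ℝ))‖)

/-- The two components of the Hellinger derivative are not linearly dependent. -/
def NotLinDep (ξη ξσ : ℝ → ℝ) : Prop :=
  ∀ a b : ℝ, (∀ᵐ y : ℝ, a * ξη y + b * ξσ y = 0) → a = 0 ∧ b = 0

/-- Interval masses of a location-scale member. -/
lemma locScale_mass (f : ℝ → ℝ) (η σ a b : ℝ) (hσ : 0 < σ) :
    ∫ y in a..b, locScale f η σ y = ∫ y in ((a - η) / σ)..((b - η) / σ), f y := by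
  unfold locScale
  rw [intervalIntegral.integral_const_mul,
    intervalIntegral.integral_comp_sub_right (fun y => f (y / σ)) η,
    intervalIntegral.integral_comp_div f hσ.ne', smul_eq_mul, ← mul_assoc,
    inv_mul_cancel₀ hσ.ne', one_mul]

lemma locScale_integrable (f : ℝ → ℝ) (hf : Integrable f) (η σ : ℝ) (hσ : 0 < σ) :
    Integrable (locScale f η σ) := by
  unfold locScale
  have h1 : Integrable (fun y => f (y / σ)) := hf.comp_div hσ.ne'
  exact (h1.comp_sub_right η).const_mul _

lemma locScale_integral (f : ℝ → ℝ) (η σ : ℝ) (hσ : 0 < σ) :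
    ∫ y, locScale f η σ y = ∫ y, f y := by
  unfold locScale
  rw [integral_const_mul, integral_sub_right_eq_self (fun y => f (y / σ)) η,
    Measure.integral_comp_div f σ, abs_of_pos hσ, smul_eq_mul, ← mul_assoc,
    inv_mul_cancel₀ hσ.ne', one_mul]

/-- Interval masses are controlled by the Hellinger distance. -/
lemma mass_le_hellinger (p q : ℝ → ℝ) (hp : Integrable p) (hq : Integrable q)
    (hp0 : ∀ y, 0 ≤ p y) (hq0 : ∀ y, 0 ≤ q y) (hp1 : ∫ y, p y = 1) (hq1 : ∫ y, q y = 1)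
    (a b t : ℝ) (hab : a ≤ b) (ht : 0 < t) :
    (∫ y in a..b, p y) - ∫ y in a..b, q y ≤ hellingerSq p q / (2 * t) + 2 * t := by
  have hI : Integrable (fun y => (Real.sqrt (p y) - Real.sqrt (q y)) ^ 2) := by
    refine Integrable.mono' ((hp.add hq).const_mul 2) ?_ ?_
    · have h1 : AEMeasurable p := hp.aemeasurable
      have h2 : AEMeasurable q := hq.aemeasurable
      exact ((h1.sqrt.sub h2.sqrt).pow_const 2).aestronglyMeasurable
    · refine Eventually.of_forall fun y => ?_
      have e1 := Real.sq_sqrt (hp0 y)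
      have e2 := Real.sq_sqrt (hq0 y)
      rw [Real.norm_eq_abs, abs_of_nonneg (sq_nonneg _)]
      simp only [Pi.add_apply]
      nlinarith [sq_nonneg (Real.sqrt (p y) + Real.sqrt (q y))]
  have hB : Integrable (fun y => (Real.sqrt (p y) - Real.sqrt (q y)) ^ 2 / (2 * t)
      + t * (p y + q y)) := (hI.div_const _).add ((hp.add hq).const_mul t)
  have hpt : ∀ y, p y - q y ≤ (Real.sqrt (p y) - Real.sqrt (q y)) ^ 2 / (2 * t)
      + t * (p y + q y) := by
    intro y
    have e1 := Real.sq_sqrt (hp0 y)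
    have e2 := Real.sq_sqrt (hq0 y)
    set u := Real.sqrt (p y)
    set v := Real.sqrt (q y)
    rw [← e1, ← e2, ← sub_nonneg]
    have : (u - v) ^ 2 / (2 * t) + t * (u ^ 2 + v ^ 2) - (u ^ 2 - v ^ 2)
        = (((u - v) - t * (u + v)) ^ 2 + t ^ 2 * (u - v) ^ 2) / (2 * t) := by
      field_simp
      ring
    rw [this]
    positivity
  have hn : ∀ y, 0 ≤ (Real.sqrt (p y) - Real.sqrt (q y)) ^ 2 / (2 * t)
      + t * (p y + q y) := fun y => by
    have := hp0 y
    have := hq0 y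
    positivity
  rw [intervalIntegral.integral_of_le hab, intervalIntegral.integral_of_le hab,
    ← integral_sub hp.integrableOn hq.integrableOn]
  calc ∫ y in Set.Ioc a b, (p y - q y)
      ≤ ∫ y in Set.Ioc a b, ((Real.sqrt (p y) - Real.sqrt (q y)) ^ 2 / (2 * t)
      + t * (p y + q y)) :=
        integral_mono (hp.sub hq).integrableOn hB.integrableOn hpt
    _ ≤ ∫ y, ((Real.sqrt (p y) - Real.sqrt (q y)) ^ 2 / (2 * t) + t * (p y + q y)) :=
        setIntegral_le_integral hB (Eventually.of_forall hn)
    _ = hellingerSq p q / (2 * t) + 2 * t := by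
        have hpq : Integrable (fun y => t * (p y + q y)) := (hp.add hq).const_mul t
        rw [integral_add (hI.div_const _) hpq, integral_div,
          integral_const_mul, integral_add hp hq, hp1, hq1]
        unfold hellingerSq
        ring

lemma small_mass (f : ℝ → ℝ) (hf : Integrable f) (hf0 : ∀ y, 0 ≤ f y) :
    ∃ δ : ℝ, 0 < δ ∧ ∀ a b : ℝ, a ≤ b → b - a ≤ δ → ∫ y in a..b, f y ≤ 1 / 4 := by
  have hfin : ∫⁻ y, ENNReal.ofReal (f y) ≠ ⊤ :=
    (hf.lintegral_lt_top).ne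
  obtain ⟨δ, hδ, h⟩ := exists_pos_setLIntegral_lt_of_measure_lt hfin
    (ε := ENNReal.ofReal (1 / 4)) (by simp)
  obtain ⟨d, hd0, hd⟩ := ENNReal.lt_iff_exists_nnreal_btwn.1 hδ
  refine ⟨d, by exact_mod_cast hd0, fun a b hab hle => ?_⟩
  have hm : volume (Set.Ioc a b) < δ := by
    rw [Real.volume_Ioc]
    refine lt_of_le_of_lt ?_ hd
    exact ENNReal.ofReal_le_of_le_toReal (by simpa using hle)
  have := h _ hm
  rw [intervalIntegral.integral_of_le hab,
    integral_eq_lintegral_of_nonneg_ae (Eventually.of_forall hf0)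
      hf.aestronglyMeasurable.restrict]
  exact ENNReal.toReal_le_of_le_ofReal (by norm_num) this.le

lemma tight_mass (f : ℝ → ℝ) (hf : Integrable f) (h1 : ∫ y, f y = 1) :
    ∃ A : ℝ, 0 < A ∧ 3 / 4 < ∫ y in (-A)..A, f y := by
  have h := intervalIntegral_tendsto_integral hf tendsto_neg_atTop_atBot
    (tendsto_id (α := ℝ) (x := atTop))
  rw [h1] at h
  have h2 := h.eventually (lt_mem_nhds (show (3 / 4 : ℝ) < 1 by norm_num))
  obtain ⟨A, hA, hA'⟩ := (h2.and (eventually_gt_atTop 0)).exists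
  exact ⟨A, hA', hA⟩

/-- After sufficiently many iterations, the affine map moves a lot of mass. -/
lemma iterate_mass (f : ℝ → ℝ) (hf : Integrable f) (hf0 : ∀ y, 0 ≤ f y) (h1 : ∫ y, f y = 1) :
    ∃ A L : ℝ, 0 < A ∧ 0 < L ∧ ∀ (c S : ℝ), 1 ≤ S → L ≤ |c| →
      1 / 2 ≤ (∫ y in (-A)..A, f y) - ∫ y in ((-A - c) / S)..((A - c) / S), f y := by
  obtain ⟨δ, hδ, hs⟩ := small_mass f hf hf0
  obtain ⟨A, hA, ht⟩ := tight_mass f hf h1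
  set R := 2 * A / δ + 1 with hR
  have hR0 : 0 < R := by positivity
  refine ⟨A, 2 * A * R + 1, hA, by positivity, fun c S hS hc => ?_⟩
  have hS0 : 0 < S := by linarith
  have hle : (-A - c) / S ≤ (A - c) / S := by gcongr; linarith
  suffices h : ∫ y in ((-A - c) / S)..((A - c) / S), f y ≤ 1 / 4 by linarith
  by_cases hSR : R ≤ S
  · apply hs _ _ hle
    rw [← sub_div, div_le_iff₀ hS0]
    have : 2 * A / δ ≤ S := by linarith
    rw [div_le_iff₀ hδ] at this
    linarith
  · push Not at hSR
    have hdis : Disjoint (Set.Ioc (-A) A) (Set.Ioc ((-A - c) / S) ((A - c) / S)) := by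
      rw [Set.disjoint_left]
      rintro x ⟨hx1, hx2⟩ ⟨hx3, hx4⟩
      rw [div_lt_iff₀ hS0] at hx3
      rw [le_div_iff₀ hS0] at hx4
      have hAS : A * S ≤ A * R := by gcongr
      have hAR : A * 1 ≤ A * R := by gcongr; linarith
      have hxS : x * S ≤ A * S := by gcongr
      have hxS' : -A * S ≤ x * S := by gcongr
      rcases abs_cases c with ⟨h, _⟩ | ⟨h, _⟩ <;> rw [h] at hc <;> linarith
    have hu : (∫ y in Set.Ioc (-A) A, f y) + ∫ y in Set.Ioc ((-A - c) / S) ((A - c) / S), f y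
        ≤ 1 := by
      rw [← setIntegral_union hdis measurableSet_Ioc hf.integrableOn hf.integrableOn, ← h1]
      exact setIntegral_le_integral hf (Eventually.of_forall hf0)
    rw [intervalIntegral.integral_of_le (by linarith)] at ht
    rw [intervalIntegral.integral_of_le hle]
    linarith

lemma hellingerSq_comm (p q : ℝ → ℝ) : hellingerSq p q = hellingerSq q p := by
  unfold hellingerSq
  congr 1
  ext y
  ring

/-- One-step comparison telescoped `n` times. -/
lemma telescope (f : ℝ → ℝ) (m s D A : ℝ) (hs : 1 ≤ s) (hA : 0 < A)
    (hstep : ∀ u v : ℝ, u ≤ v →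
      (∫ y in u..v, f y) - ∫ y in ((u - m) / s)..((v - m) / s), f y ≤ D) (n : ℕ) :
    (∫ y in (-A)..A, f y) - ∫ y in ((-A - m * ∑ i ∈ Finset.range n, s ^ i) / s ^ n)..
      ((A - m * ∑ i ∈ Finset.range n, s ^ i) / s ^ n), f y ≤ n * D := by
  have hs0 : 0 < s := by linarith
  induction n with
  | zero => simp
  | succ n ih =>
    have h := hstep ((-A - m * ∑ i ∈ Finset.range n, s ^ i) / s ^ n)
      ((A - m * ∑ i ∈ Finset.range n, s ^ i) / s ^ n) (by gcongr; linarith)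
    have e : ∀ B : ℝ, ((B - m * ∑ i ∈ Finset.range n, s ^ i) / s ^ n - m) / s
        = (B - m * ∑ i ∈ Finset.range (n + 1), s ^ i) / s ^ (n + 1) := by
      intro B
      rw [Finset.sum_range_succ]
      field_simp
      ring
    rw [e, e] at h
    push_cast
    linarith

/-- under Hellinger differentiability at `(0,1)` with linearly independent
derivative components, the squared Hellinger distance between two members of the
location-scale family is bounded below by a constant multiple of the squared difference
of the location parameters, uniformly over compact location and scale ranges. -/
theorem hellinger_squared_lower_bound
    (f : ℝ → ℝ) (hf_nonneg : ∀ y, 0 ≤ f y) (hf_int : ∫ y, f y = 1)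
    (ξη ξσ : ℝ → ℝ) (hdiff : HellingerDiffAt f ξη ξσ) (hindep : NotLinDep ξη ξσ)
    (J : ℝ) (hJ : 0 < J) (σbar : ℝ) (hσbar : 1 < σbar) :
    ∃ Clow : ℝ, 0 < Clow ∧
      ∀ μ₁ μ₂ σ₁ σ₂ : ℝ, μ₁ ∈ Set.Icc (-J) J → μ₂ ∈ Set.Icc (-J) J →
        σ₁ ∈ Set.Icc σbar⁻¹ σbar → σ₂ ∈ Set.Icc σbar⁻¹ σbar →
        Clow * (μ₁ - μ₂) ^ 2 ≤ hellingerSq (locScale f μ₁ σ₁) (locScale f μ₂ σ₂) := by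
  clear hdiff hindep
  have hf : Integrable f := by
    by_contra h
    rw [integral_undef h] at hf_int
    exact zero_ne_one hf_int
  obtain ⟨A, L, hA, hL, hit⟩ := iterate_mass f hf hf_nonneg hf_int
  have hσ0 : 0 < σbar := by linarith
  set M := 2 * J * σbar with hM
  have hM0 : 0 < M := by positivity
  refine ⟨1 / (16 * (L + M) ^ 2 * σbar ^ 2), by positivity, ?_⟩
  have key : ∀ μ₁ μ₂ σ₁ σ₂ : ℝ, μ₁ ∈ Set.Icc (-J) J → μ₂ ∈ Set.Icc (-J) J →
        σ₁ ∈ Set.Icc σbar⁻¹ σbar → σ₂ ∈ Set.Icc σbar⁻¹ σbar → σ₂ ≤ σ₁ →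
        1 / (16 * (L + M) ^ 2 * σbar ^ 2) * (μ₁ - μ₂) ^ 2 ≤
          hellingerSq (locScale f μ₁ σ₁) (locScale f μ₂ σ₂) := by
    intro μ₁ μ₂ σ₁ σ₂ hμ₁ hμ₂ hσ₁ hσ₂ hσ
    have hi0 : 0 < σbar⁻¹ := by positivity
    have p1 : 0 < σ₁ := lt_of_lt_of_le hi0 hσ₁.1
    have p2 : 0 < σ₂ := lt_of_lt_of_le hi0 hσ₂.1
    set H := hellingerSq (locScale f μ₁ σ₁) (locScale f μ₂ σ₂) with hH
    have hH0 : 0 ≤ H := integral_nonneg fun y => sq_nonneg _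
    rcases eq_or_ne μ₁ μ₂ with rfl | hne
    · simpa using hH0
    set m := (μ₁ - μ₂) / σ₂ with hm
    set s := σ₁ / σ₂ with hs
    have hs1 : 1 ≤ s := by rw [hs, le_div_iff₀ p2]; linarith
    have hm0 : 0 < |m| := abs_pos.2 (div_ne_zero (sub_ne_zero.2 hne) p2.ne')
    have hmM : |m| ≤ M := by
      rw [hm, abs_div, abs_of_pos p2, div_le_iff₀ p2]
      have h1 : |μ₁ - μ₂| ≤ 2 * J := by
        rw [abs_le]; constructor <;> linarith [hμ₁.1, hμ₁.2, hμ₂.1, hμ₂.2]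
      have h2 : 1 ≤ σbar * σ₂ := by
        have := mul_le_mul_of_nonneg_left hσ₂.1 hσ0.le
        rwa [mul_inv_cancel₀ hσ0.ne'] at this
      rw [hM]
      nlinarith
    set n := ⌈L / |m|⌉₊ with hn
    have hn1 : L / |m| ≤ n := Nat.le_ceil _
    have hn2 : (n : ℝ) < L / |m| + 1 := Nat.ceil_lt_add_one (by positivity)
    have hn0 : (0 : ℝ) < n := lt_of_lt_of_le (by positivity) hn1
    have hLn : L ≤ n * |m| := by rwa [div_le_iff₀ hm0] at hn1
    have hnM : n * |m| ≤ L + M := by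
      have := mul_le_mul_of_nonneg_right hn2.le hm0.le
      rw [add_mul, div_mul_cancel₀ _ hm0.ne'] at this
      linarith
    have hstep : ∀ u v : ℝ, u ≤ v →
      (∫ y in u..v, f y) - ∫ y in ((u - m) / s)..((v - m) / s), f y
        ≤ H / (2 * (1 / (8 * n))) + 2 * (1 / (8 * n)) := by
      intro u v huv
      have hh := mass_le_hellinger (locScale f μ₂ σ₂) (locScale f μ₁ σ₁)
        (locScale_integrable f hf _ _ p2) (locScale_integrable f hf _ _ p1)
        (fun y => mul_nonneg (by positivity) (hf_nonneg _))
        (fun y => mul_nonneg (by positivity) (hf_nonneg _))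
        (by rw [locScale_integral f _ _ p2, hf_int]) (by rw [locScale_integral f _ _ p1, hf_int])
        (σ₂ * u + μ₂) (σ₂ * v + μ₂) (1 / (8 * n)) (by gcongr) (by positivity)
      rw [hellingerSq_comm, ← hH, locScale_mass f _ _ _ _ p2, locScale_mass f _ _ _ _ p1] at hh
      have e1 : ∀ w : ℝ, (σ₂ * w + μ₂ - μ₂) / σ₂ = w := fun w => by field_simp; ring
      have e2 : ∀ w : ℝ, (σ₂ * w + μ₂ - μ₁) / σ₁ = (w - m) / s := fun w => by
        rw [hm, hs]; field_simp; ring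
      rwa [e1, e1, e2, e2] at hh
    have htel := telescope f m s _ A hs1 hA hstep n
    have hsum : (n : ℝ) ≤ ∑ i ∈ Finset.range n, s ^ i := by
      calc (n : ℝ) = ∑ i ∈ Finset.range n, (1 : ℝ) := by simp
        _ ≤ _ := Finset.sum_le_sum fun i _ => one_le_pow₀ hs1
    have hbig := hit (m * ∑ i ∈ Finset.range n, s ^ i) (s ^ n) (one_le_pow₀ hs1) (by
      rw [abs_mul, abs_of_nonneg (hn0.le.trans hsum)]
      nlinarith)
    have hfin : 1 / 2 ≤ 4 * (n : ℝ) ^ 2 * H + 1 / 4 := by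
      refine (hbig.trans htel).trans (le_of_eq ?_)
      field_simp
      ring
    have hsq : (n * |m|) ^ 2 ≤ (L + M) ^ 2 := by gcongr
    rw [mul_pow, sq_abs] at hsq
    have hmσ : (μ₁ - μ₂) ^ 2 ≤ m ^ 2 * σbar ^ 2 := by
      have : μ₁ - μ₂ = m * σ₂ := by rw [hm]; field_simp
      rw [this, mul_pow]
      have := hσ₂.2
      gcongr
    rw [one_div, inv_mul_le_iff₀ (by positivity)]
    calc (μ₁ - μ₂) ^ 2 ≤ m ^ 2 * σbar ^ 2 := hmσ
      _ ≤ (m ^ 2 * (16 * n ^ 2 * H)) * σbar ^ 2 := by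
        gcongr
        exact le_mul_of_one_le_right (sq_nonneg _) (by linarith)
      _ = 16 * (n ^ 2 * m ^ 2) * σbar ^ 2 * H := by ring
      _ ≤ 16 * (L + M) ^ 2 * σbar ^ 2 * H := by gcongr
  intro μ₁ μ₂ σ₁ σ₂ hμ₁ hμ₂ hσ₁ hσ₂
  rcases le_total σ₂ σ₁ with h | h
  · exact key μ₁ μ₂ σ₁ σ₂ hμ₁ hμ₂ hσ₁ hσ₂ h
  · have := key μ₂ μ₁ σ₂ σ₁ hμ₂ hμ₁ hσ₂ hσ₁ h
    rw [hellingerSq_comm]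
    calc _ = 1 / (16 * (L + M) ^ 2 * σbar ^ 2) * (μ₂ - μ₁) ^ 2 := by ring
      _ ≤ _ := this
end

section
/- Let f(y) = (2/√π) · (√(φ(1−φ))/(√φ + √(1−φ))) · exp[−φ y² 1{y ≥ 0} − (1−φ) y² 1{y < 0}] be the standard asymmetric normal density with 0 < φ < 1, and let f_{η,σ}(y) = (1/σ) f((y−η)/σ) be its location-scale family. Then: (a) D(f_{0,1} ‖ f_{η,σ}) is twice differentiable in (η,σ) at (0,1), so that D(f_{0,1} ‖ f_{η,σ}) = O(η² + (σ−1)²) as (η,σ) → (0,1); and (b) the family is Hellinger differentiable at (η,σ) = (0,1), with the square-integrable location Hellinger derivative ξ̇_{(0,1)_η}(y) = −(1/2) f′(y) 1{f(y)>0}/√(f(y)) satisfying both ∫ ξ̇²_{(0,1)_η}(y) dy < ∞ and ∫ y² ξ̇²_{(0,1)_η}(y) dy < ∞. -/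
open MeasureTheory Filter Asymptotics Topology

/-- The standard asymmetric normal density with skewness `φ`. -/
noncomputable def asymNormalDensity (φ : ℝ) : ℝ → ℝ := fun y =>
  2 / Real.sqrt Real.pi * (Real.sqrt (φ * (1 - φ)) / (Real.sqrt φ + Real.sqrt (1 - φ))) *
    Real.exp (-(if 0 ≤ y then φ * y ^ 2 else (1 - φ) * y ^ 2))

/-- Kullback–Leibler divergence `D(q₁‖q₂) = ∫ q₁ log(q₁/q₂) dy` (Lebesgue measure). -/
noncomputable def klDiv (q₁ q₂ : ℝ → ℝ) : ℝ := ∫ y, q₁ y * Real.log (q₁ y / q₂ y)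

/-- The candidate location Hellinger derivative of the asymmetric normal family at
`(0,1)`: `ξ̇_{(0,1)_η}(y) = -(1/2) f'(y) 1{f(y)>0}/√(f(y))`. -/
noncomputable def asymNormalXi (φ : ℝ) : ℝ → ℝ := fun y =>
  -(1 / 2) * deriv (asymNormalDensity φ) y *
    (if 0 < asymNormalDensity φ y then 1 else 0) / Real.sqrt (asymNormalDensity φ y)


namespace AN

noncomputable def g (φ y : ℝ) : ℝ := φ * (max y 0) ^ 2 + (1 - φ) * (min y 0) ^ 2
noncomputable def gd (φ y : ℝ) : ℝ := 2 * φ * max y 0 + 2 * (1 - φ) * min y 0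
noncomputable def c (φ : ℝ) : ℝ :=
  2 / Real.sqrt Real.pi * (Real.sqrt (φ * (1 - φ)) / (Real.sqrt φ + Real.sqrt (1 - φ)))

lemma c_pos {φ : ℝ} (h0 : 0 < φ) (h1 : φ < 1) : 0 < c φ := by
  have h2 : 0 < 1 - φ := by linarith
  unfold c
  have := Real.pi_pos
  positivity

lemma dens_eq (φ y : ℝ) : asymNormalDensity φ y = c φ * Real.exp (-g φ y) := by
  unfold asymNormalDensity c g
  congr 3
  split_ifs with h
  · simp [h]
  · rw [max_eq_right (by linarith), min_eq_left (by linarith)]; ring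

lemma g_cont (φ : ℝ) : Continuous (g φ) := by unfold g; fun_prop
lemma gd_cont (φ : ℝ) : Continuous (gd φ) := by unfold gd; fun_prop

lemma g_bounds {φ : ℝ} (h0 : 0 < φ) (h1 : φ < 1) (y : ℝ) :
    min φ (1 - φ) * y ^ 2 ≤ g φ y ∧ g φ y ≤ y ^ 2 ∧ |gd φ y| ≤ 2 * |y| ∧ y * gd φ y = 2 * g φ y := by
  unfold g gd
  rcases le_total 0 y with h | h
  · simp only [max_eq_left h, min_eq_right h, abs_of_nonneg h]
    refine ⟨?_, by nlinarith, ?_, by ring⟩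
    · have := min_le_left φ (1 - φ); nlinarith
    · rw [abs_le]; constructor <;> nlinarith
  · simp only [max_eq_right h, min_eq_left h, abs_of_nonpos h]
    refine ⟨?_, by nlinarith, ?_, by ring⟩
    · have := min_le_right φ (1 - φ); nlinarith
    · rw [abs_le]; constructor <;> nlinarith

lemma g_quad {φ : ℝ} (h0 : 0 < φ) (h1 : φ < 1) (y η : ℝ) :
    |g φ (y - η) - g φ y + η * gd φ y| ≤ η ^ 2 := by
  unfold g gd
  have h2 : 0 < 1 - φ := by linarith
  rw [abs_le]
  rcases le_total 0 y with h | h <;> rcases le_total 0 (y - η) with h' | h'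
  · simp only [max_eq_left h, min_eq_right h, max_eq_left h', min_eq_right h']
    constructor <;> nlinarith [sq_nonneg η]
  · simp only [max_eq_left h, min_eq_right h, max_eq_right h', min_eq_left h']
    have k : (y - η) ^ 2 ≤ η ^ 2 := by nlinarith
    have k1 := mul_le_mul_of_nonneg_left k h0.le
    have k2 := mul_le_mul_of_nonneg_left k h2.le
    constructor <;> nlinarith [sq_nonneg η, sq_nonneg (y - η), mul_nonneg h0.le (sq_nonneg (y-η)), mul_nonneg h2.le (sq_nonneg (y-η))]
  · simp only [max_eq_right h, min_eq_left h, max_eq_left h', min_eq_right h']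
    have k : (y - η) ^ 2 ≤ η ^ 2 := by nlinarith
    have k1 := mul_le_mul_of_nonneg_left k h0.le
    have k2 := mul_le_mul_of_nonneg_left k h2.le
    constructor <;> nlinarith [sq_nonneg η, sq_nonneg (y - η), mul_nonneg h0.le (sq_nonneg (y-η)), mul_nonneg h2.le (sq_nonneg (y-η))]
  · simp only [max_eq_right h, min_eq_left h, max_eq_right h', min_eq_left h']
    constructor <;> nlinarith [sq_nonneg η]

lemma g_scale (φ y : ℝ) {σ : ℝ} (hσ : 0 < σ) : g φ (y / σ) = g φ y / σ ^ 2 := by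
  unfold g
  rcases le_total 0 y with h | h
  · have h' : 0 ≤ y / σ := by positivity
    simp only [max_eq_left h, min_eq_right h, max_eq_left h', min_eq_right h']
    field_simp
    ring
  · have h' : y / σ ≤ 0 := div_nonpos_of_nonpos_of_nonneg h hσ.le
    simp only [max_eq_right h, min_eq_left h, max_eq_right h', min_eq_left h']
    field_simp
    ring

lemma g_hasDeriv {φ : ℝ} (h0 : 0 < φ) (h1 : φ < 1) (y : ℝ) : HasDerivAt (g φ) (gd φ y) y := by
  rw [hasDerivAt_iff_isLittleO_nhds_zero]
  have : (fun h : ℝ => g φ (y + h) - g φ y - h • gd φ y) =O[𝓝 0] (fun h : ℝ => h ^ 2) := by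
    apply IsBigO.of_bound 1
    filter_upwards with h
    have := g_quad h0 h1 y (-h)
    rw [sub_neg_eq_add] at this
    simp only [Real.norm_eq_abs, one_mul, smul_eq_mul]
    rw [abs_of_nonneg (sq_nonneg h)]
    rw [neg_sq] at this
    rwa [show g φ (y + h) - g φ y - h * gd φ y = g φ (y + h) - g φ y + -h * gd φ y by ring]
  exact this.trans_isLittleO (by simpa using isLittleO_pow_pow (𝕜 := ℝ) (m := 1) (n := 2) (by norm_num))

lemma f_hasDeriv {φ : ℝ} (h0 : 0 < φ) (h1 : φ < 1) (y : ℝ) :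
    HasDerivAt (asymNormalDensity φ) (-(gd φ y * asymNormalDensity φ y)) y := by
  have : asymNormalDensity φ = fun y => c φ * Real.exp (-g φ y) := funext (dens_eq φ)
  rw [this]
  have h : HasDerivAt (fun y => -g φ y) (-gd φ y) y := (g_hasDeriv h0 h1 y).neg
  exact ((h.exp).const_mul (c φ)).congr_deriv (by ring)

lemma f_contDiff {φ : ℝ} (h0 : 0 < φ) (h1 : φ < 1) : ContDiff ℝ 1 (asymNormalDensity φ) := by
  rw [contDiff_one_iff_deriv]
  have hd : Differentiable ℝ (asymNormalDensity φ) := fun y => (f_hasDeriv h0 h1 y).differentiableAt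
  refine ⟨hd, ?_⟩
  have : deriv (asymNormalDensity φ) = fun y => -(gd φ y * asymNormalDensity φ y) :=
    funext fun y => (f_hasDeriv h0 h1 y).deriv
  rw [this]
  exact ((gd_cont φ).mul hd.continuous).neg

lemma f_pos {φ : ℝ} (h0 : 0 < φ) (h1 : φ < 1) (y : ℝ) : 0 < asymNormalDensity φ y := by
  rw [dens_eq]; exact mul_pos (c_pos h0 h1) (Real.exp_pos _)

lemma int_exp {b : ℝ} (hb : 0 < b) (k : ℕ) : Integrable (fun y : ℝ => y ^ k * Real.exp (-b * y ^ 2)) := by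
  have := integrable_rpow_mul_exp_neg_mul_sq hb (s := (k : ℝ)) (by have : (0:ℝ) ≤ k := by positivity
                                                                   linarith)
  simpa [Real.rpow_natCast] using this

lemma f_le {φ : ℝ} (h0 : 0 < φ) (h1 : φ < 1) (y : ℝ) :
    asymNormalDensity φ y ≤ c φ * Real.exp (-min φ (1 - φ) * y ^ 2) := by
  rw [dens_eq]
  have := c_pos h0 h1
  have := (g_bounds h0 h1 y).1
  gcongr
  linarith

lemma int_f {φ : ℝ} (h0 : 0 < φ) (h1 : φ < 1) (k : ℕ) :
    Integrable (fun y : ℝ => y ^ k * asymNormalDensity φ y) := by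
  have hm : 0 < min φ (1 - φ) := lt_min h0 (by linarith)
  refine ((int_exp hm k).const_mul (c φ)).mono ?_ ?_
  · exact ((continuous_pow k).mul (f_contDiff h0 h1).continuous).aestronglyMeasurable
  · filter_upwards with y
    have h := f_le h0 h1 y
    have h' := f_pos h0 h1 y
    have hc := c_pos h0 h1
    rw [norm_mul, norm_mul, norm_mul, Real.norm_of_nonneg h'.le, Real.norm_of_nonneg hc.le,
      Real.norm_of_nonneg (Real.exp_pos _).le]
    calc _ ≤ ‖y ^ k‖ * (c φ * Real.exp (-min φ (1 - φ) * y ^ 2)) := by gcongr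
      _ = _ := by ring

/-- anything continuous with polynomial growth is integrable against f -/
lemma int_of_bound {φ : ℝ} (h0 : 0 < φ) (h1 : φ < 1) (p : ℝ → ℝ) (hp : Continuous p) (C : ℝ)
    (hb : ∀ y, |p y| ≤ C * (1 + y ^ 4)) : Integrable (fun y : ℝ => p y * asymNormalDensity φ y) := by
  refine (((int_f h0 h1 0).add (int_f h0 h1 4)).const_mul C).mono
    (hp.mul (f_contDiff h0 h1).continuous).aestronglyMeasurable ?_
  filter_upwards with y
  have h' := f_pos h0 h1 y
  rw [norm_mul, Real.norm_of_nonneg h'.le, Real.norm_eq_abs]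
  refine le_trans ?_ (le_abs_self _)
  calc _ ≤ C * (1 + y ^ 4) * asymNormalDensity φ y := by gcongr; exact hb y
    _ = _ := by simp only [Pi.add_apply]; ring

lemma int_gd {φ : ℝ} (h0 : 0 < φ) (h1 : φ < 1) :
    Integrable (fun y : ℝ => gd φ y * asymNormalDensity φ y) := by
  refine int_of_bound h0 h1 _ (gd_cont φ) 2 fun y => ?_
  have := (g_bounds h0 h1 y).2.2.1
  have h3 : |y| ≤ 1 + y ^ 4 := by
    rw [← Even.pow_abs (by decide : Even 4)]
    nlinarith [sq_nonneg (|y| - 1/2), sq_nonneg (|y|^2 - 1/2)]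
  linarith

lemma int_g {φ : ℝ} (h0 : 0 < φ) (h1 : φ < 1) (η : ℝ) :
    Integrable (fun y : ℝ => g φ (y - η) * asymNormalDensity φ y) := by
  refine int_of_bound h0 h1 (fun y => g φ (y - η)) ((g_cont φ).comp (by fun_prop)) (2 + 2 * η ^ 2) fun y => ?_
  obtain ⟨a1, a2, -, -⟩ := g_bounds h0 h1 (y - η)
  have hm : 0 < min φ (1 - φ) := lt_min h0 (by linarith)
  rw [abs_of_nonneg (le_trans (by positivity) a1)]
  nlinarith [sq_nonneg (y + η), sq_nonneg (y^2 - 1), mul_nonneg (sq_nonneg η) (sq_nonneg (y^2)), sq_nonneg (y^2)]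

lemma int_gd_zero {φ : ℝ} (h0 : 0 < φ) (h1 : φ < 1) :
    ∫ y, gd φ y * asymNormalDensity φ y = 0 := by
  have := integral_eq_zero_of_hasDerivAt_of_integrable (f_hasDeriv h0 h1) (int_gd h0 h1).neg
    (by simpa using int_f h0 h1 0)
  rw [integral_neg] at this
  linarith

lemma int_g_eq {φ : ℝ} (h0 : 0 < φ) (h1 : φ < 1) :
    ∫ y, asymNormalDensity φ y = 2 * ∫ y, g φ y * asymNormalDensity φ y := by
  have i0 : Integrable (asymNormalDensity φ) := by simpa using int_f h0 h1 0
  have i1 : Integrable (fun y => g φ y * asymNormalDensity φ y) := by simpa using int_g h0 h1 0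
  have hd : ∀ y, HasDerivAt (fun y => y * asymNormalDensity φ y)
      (asymNormalDensity φ y - 2 * (g φ y * asymNormalDensity φ y)) y := fun y => by
    have := (g_bounds h0 h1 y).2.2.2
    refine ((hasDerivAt_id' y).mul (f_hasDeriv h0 h1 y)).congr_deriv ?_
    linear_combination (-asymNormalDensity φ y) * this
  have := integral_eq_zero_of_hasDerivAt_of_integrable hd (i0.sub (i1.const_mul 2))
    (by simpa using int_f h0 h1 1)
  rw [integral_sub i0 (i1.const_mul 2), integral_const_mul] at this
  linarith

noncomputable def M (φ : ℝ) (k : ℕ) (η : ℝ) : ℝ :=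
  ∫ y in Set.Iic η, y ^ k * asymNormalDensity φ y

lemma M_contDiff {φ : ℝ} (h0 : 0 < φ) (h1 : φ < 1) (k : ℕ) : ContDiff ℝ 2 (M φ k) := by
  have hc : ContDiff ℝ 1 (fun y : ℝ => y ^ k * asymNormalDensity φ y) :=
    (contDiff_id.pow k).mul (f_contDiff h0 h1)
  have hM : ∀ η, HasDerivAt (M φ k) (η ^ k * asymNormalDensity φ η) η := by
    intro η
    have e : M φ k = fun η => M φ k 0 + ∫ y in (0:ℝ)..η, y ^ k * asymNormalDensity φ y := by
      funext η
      have := intervalIntegral.integral_Iic_sub_Iic (a := 0) (b := η)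
        (int_f h0 h1 k).integrableOn (int_f h0 h1 k).integrableOn
      unfold M
      linarith
    rw [e]
    exact (intervalIntegral.integral_hasDerivAt_right (hc.continuous.intervalIntegrable _ _)
      hc.continuous.stronglyMeasurable.stronglyMeasurableAtFilter
      hc.continuous.continuousAt).const_add _
  rw [show (2 : WithTop ℕ∞) = 1 + 1 by norm_num, contDiff_succ_iff_deriv]
  refine ⟨fun y => (hM y).differentiableAt, by simp, ?_⟩
  rwa [show deriv (M φ k) = _ from funext fun y => (hM y).deriv]

noncomputable def G (φ η : ℝ) : ℝ := ∫ y, g φ (y - η) * asymNormalDensity φ y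

lemma G_eq {φ : ℝ} (h0 : 0 < φ) (h1 : φ < 1) (η : ℝ) :
    G φ η = φ * ((∫ y, y ^ 2 * asymNormalDensity φ y) - 2 * η * (∫ y, y ^ 1 * asymNormalDensity φ y)
      + η ^ 2 * ∫ y, y ^ 0 * asymNormalDensity φ y)
      + (1 - 2 * φ) * (M φ 2 η - 2 * η * M φ 1 η + η ^ 2 * M φ 0 η) := by
  have I := int_f h0 h1
  have e : (fun y => g φ (y - η) * asymNormalDensity φ y) = fun y =>
      φ * (y ^ 2 * asymNormalDensity φ y - 2 * η * (y ^ 1 * asymNormalDensity φ y)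
        + η ^ 2 * (y ^ 0 * asymNormalDensity φ y))
      + (1 - 2 * φ) * (Set.Iic η).indicator (fun y => y ^ 2 * asymNormalDensity φ y -
        2 * η * (y ^ 1 * asymNormalDensity φ y) + η ^ 2 * (y ^ 0 * asymNormalDensity φ y)) y := by
    funext y
    unfold g
    by_cases h : y ≤ η
    · rw [Set.indicator_of_mem (by exact h), max_eq_right (by linarith), min_eq_left (by linarith)]
      ring
    · rw [Set.indicator_of_notMem (by exact h), max_eq_left (by linarith), min_eq_right (by linarith)]
      ring
  have i1 : Integrable (fun y => y ^ 2 * asymNormalDensity φ y -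
        2 * η * (y ^ 1 * asymNormalDensity φ y)) := (I 2).sub ((I 1).const_mul _)
  have i2 : Integrable (fun y => η ^ 2 * (y ^ 0 * asymNormalDensity φ y)) := (I 0).const_mul _
  have i3 : Integrable (fun y => y ^ 2 * asymNormalDensity φ y -
        2 * η * (y ^ 1 * asymNormalDensity φ y) + η ^ 2 * (y ^ 0 * asymNormalDensity φ y)) :=
    i1.add i2
  unfold G
  rw [e, integral_add (i3.const_mul _) ((i3.indicator measurableSet_Iic).const_mul _),
    integral_const_mul, integral_const_mul, integral_indicator measurableSet_Iic,
    integral_add i1 i2, integral_sub (I 2) ((I 1).const_mul _),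
    integral_const_mul, integral_const_mul,
    integral_add i1.integrableOn i2.integrableOn,
    integral_sub (I 2).integrableOn ((I 1).const_mul _).integrableOn,
    integral_const_mul, integral_const_mul]
  rfl

lemma G_contDiff {φ : ℝ} (h0 : 0 < φ) (h1 : φ < 1) : ContDiff ℝ 2 (G φ) := by
  rw [show G φ = _ from funext (G_eq h0 h1)]
  have := M_contDiff h0 h1 0
  have := M_contDiff h0 h1 1
  have := M_contDiff h0 h1 2
  fun_prop

lemma G_quad {φ : ℝ} (h0 : 0 < φ) (h1 : φ < 1) (η : ℝ) :
    |G φ η - G φ 0| ≤ η ^ 2 * ∫ y, asymNormalDensity φ y := by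
  have i0 : Integrable (asymNormalDensity φ) := by simpa using int_f h0 h1 0
  have i1 := int_g h0 h1 η
  have i2 := int_g h0 h1 0
  have i3 := int_gd h0 h1
  have e : G φ η - G φ 0 = ∫ y, ((g φ (y - η) * asymNormalDensity φ y -
      g φ (y - 0) * asymNormalDensity φ y) + η * (gd φ y * asymNormalDensity φ y)) := by
    have i4 : Integrable (fun y => g φ (y - η) * asymNormalDensity φ y -
      g φ (y - 0) * asymNormalDensity φ y) := i1.sub i2
    rw [integral_add i4 (i3.const_mul _), integral_sub i1 i2, integral_const_mul,
      int_gd_zero h0 h1]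
    simp [G]
  rw [e, ← integral_const_mul, ← Real.norm_eq_abs]
  refine norm_integral_le_of_norm_le (i0.const_mul _) ?_
  filter_upwards with y
  have hf := f_pos h0 h1 y
  rw [show g φ (y - η) * asymNormalDensity φ y -
      g φ (y - 0) * asymNormalDensity φ y + η * (gd φ y * asymNormalDensity φ y)
      = (g φ (y - η) - g φ y + η * gd φ y) * asymNormalDensity φ y by rw [sub_zero]; ring,
    norm_mul, Real.norm_of_nonneg hf.le, Real.norm_eq_abs]
  gcongr
  exact g_quad h0 h1 y η

lemma loc_eq (φ y η : ℝ) {σ : ℝ} (hσ : 0 < σ) :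
    locScale (asymNormalDensity φ) η σ y = σ⁻¹ * (c φ * Real.exp (-(g φ (y - η) / σ ^ 2))) := by
  unfold locScale
  rw [dens_eq, g_scale φ _ hσ]

lemma kl_eq {φ : ℝ} (h0 : 0 < φ) (h1 : φ < 1) (η : ℝ) {σ : ℝ} (hσ : 0 < σ) :
    klDiv (asymNormalDensity φ) (locScale (asymNormalDensity φ) η σ) =
      2 * G φ 0 * Real.log σ - G φ 0 + G φ η / σ ^ 2 := by
  have i0 : Integrable (asymNormalDensity φ) := by simpa using int_f h0 h1 0
  have i1 := int_g h0 h1 η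
  have i2 := int_g h0 h1 0
  have hc := c_pos h0 h1
  have e : (fun y => asymNormalDensity φ y *
      Real.log (asymNormalDensity φ y / locScale (asymNormalDensity φ) η σ y)) = fun y =>
      (Real.log σ * asymNormalDensity φ y - g φ (y - 0) * asymNormalDensity φ y)
       + (σ ^ 2)⁻¹ * (g φ (y - η) * asymNormalDensity φ y) := by
    funext y
    have : Real.log (asymNormalDensity φ y / locScale (asymNormalDensity φ) η σ y)
        = Real.log σ - g φ y + (σ ^ 2)⁻¹ * g φ (y - η) := by
      rw [loc_eq φ y η hσ, dens_eq, Real.log_div (by positivity) (by positivity),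
        Real.log_mul (by positivity) (by positivity), Real.log_mul (by positivity) (by positivity),
        Real.log_mul (by positivity) (by positivity), Real.log_inv, Real.log_exp, Real.log_exp]
      ring
    rw [this, sub_zero]
    ring
  have i4 : Integrable (fun y => Real.log σ * asymNormalDensity φ y -
      g φ (y - 0) * asymNormalDensity φ y) := (i0.const_mul _).sub i2
  unfold klDiv
  rw [e, integral_add i4 (i1.const_mul _), integral_sub (i0.const_mul _) i2,
    integral_const_mul, integral_const_mul, int_g_eq h0 h1]
  simp only [G, sub_zero]
  ring

lemma ev_pos : ∀ᶠ θ : ℝ × ℝ in 𝓝 ((0 : ℝ), (1 : ℝ)), 0 < θ.2 :=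
  continuous_snd.continuousAt.eventually (lt_mem_nhds (by norm_num))

lemma partA {φ : ℝ} (h0 : 0 < φ) (h1 : φ < 1) :  ContDiffAt ℝ 2
      (fun θ : ℝ × ℝ =>
        klDiv (asymNormalDensity φ) (locScale (asymNormalDensity φ) θ.1 θ.2))
      ((0 : ℝ), (1 : ℝ)) := by
  have : ContDiffAt ℝ 2 (fun θ : ℝ × ℝ => 2 * G φ 0 * Real.log θ.2 - G φ 0 + G φ θ.1 / θ.2 ^ 2)
      ((0 : ℝ), (1 : ℝ)) := by
    have hG := G_contDiff h0 h1
    refine ContDiffAt.add (ContDiffAt.sub (contDiffAt_const.mul (contDiffAt_snd.log (by simp)))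
      contDiffAt_const) (ContDiffAt.div ?_ (contDiffAt_snd.pow 2) (by simp))
    exact (hG.comp contDiff_fst).contDiffAt
  refine this.congr_of_eventuallyEq ?_
  filter_upwards [ev_pos] with θ hθ using kl_eq h0 h1 _ hθ

lemma partA2 {φ : ℝ} (h0 : 0 < φ) (h1 : φ < 1) :
    (fun θ : ℝ × ℝ =>
        klDiv (asymNormalDensity φ) (locScale (asymNormalDensity φ) θ.1 θ.2))
      =O[𝓝 ((0 : ℝ), (1 : ℝ))] (fun θ : ℝ × ℝ => θ.1 ^ 2 + (θ.2 - 1) ^ 2) := by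
  have hG0 : 0 ≤ G φ 0 := by
    have := int_g_eq h0 h1
    have h3 : 0 ≤ ∫ y, asymNormalDensity φ y := integral_nonneg fun y => (f_pos h0 h1 y).le
    simp only [G, sub_zero]; linarith
  have hI : ∫ y, asymNormalDensity φ y = 2 * G φ 0 := by
    rw [int_g_eq h0 h1]; simp [G]
  have hs : ∀ᶠ θ : ℝ × ℝ in 𝓝 ((0 : ℝ), (1 : ℝ)), (1:ℝ)/2 < θ.2 ∧ θ.2 < 3/2 :=
    continuous_snd.continuousAt.eventually (Ioo_mem_nhds (by norm_num) (by norm_num))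
  apply IsBigO.of_bound (16 * G φ 0)
  filter_upwards [hs] with θ hθ
  obtain ⟨η, s⟩ := θ
  obtain ⟨a, b⟩ := hθ
  simp only at a b ⊢
  have sp : 0 < s := by linarith
  rw [kl_eq h0 h1 _ sp, Real.norm_eq_abs, Real.norm_of_nonneg (by positivity)]
  have q := G_quad h0 h1 η
  rw [hI] at q
  have hinv : (s ^ 2)⁻¹ ≤ 4 := by
    rw [inv_le_comm₀ (by positivity) (by norm_num)]; nlinarith
  have hinv0 : 0 < (s ^ 2)⁻¹ := by positivity
  have k1 : Real.log s ≤ s - 1 := Real.log_le_sub_one_of_pos sp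
  have k2 : 1 - (s ^ 2)⁻¹ ≤ 2 * Real.log s := by
    have := Real.one_sub_inv_le_log_of_pos (x := s ^ 2) (by positivity)
    rwa [Real.log_pow, Nat.cast_ofNat] at this
  set L := 2 * Real.log s - 1 + (s ^ 2)⁻¹ with hL
  have l1 : 0 ≤ L := by linarith
  have l2 : L ≤ 16 * (s - 1) ^ 2 := by
    have : 2 * (s - 1) - 1 + (s ^ 2)⁻¹ = (s - 1) ^ 2 * (2 * s + 1) * (s ^ 2)⁻¹ := by
      field_simp; ring
    calc L ≤ (s - 1) ^ 2 * (2 * s + 1) * (s ^ 2)⁻¹ := by linarith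
      _ ≤ (s - 1) ^ 2 * 4 * 4 := by gcongr; linarith
      _ = _ := by ring
  have e : 2 * G φ 0 * Real.log s - G φ 0 + G φ η / s ^ 2 =
      G φ 0 * L + (G φ η - G φ 0) * (s ^ 2)⁻¹ := by rw [hL]; ring
  rw [e]
  refine (abs_add_le _ _).trans ?_
  rw [abs_mul, abs_mul, abs_of_nonneg hG0, abs_of_nonneg l1, abs_of_pos hinv0]
  have m1 : G φ 0 * L ≤ G φ 0 * (16 * (s - 1) ^ 2) := by gcongr
  have m2 : |G φ η - G φ 0| * (s ^ 2)⁻¹ ≤ η ^ 2 * (2 * G φ 0) * 4 := by gcongr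
  nlinarith [mul_nonneg (sq_nonneg η) hG0]

lemma xi_eq {φ : ℝ} (h0 : 0 < φ) (h1 : φ < 1) (y : ℝ) :
    asymNormalXi φ y = 1 / 2 * gd φ y * Real.sqrt (asymNormalDensity φ y) := by
  unfold asymNormalXi
  have hf := f_pos h0 h1 y
  rw [(f_hasDeriv h0 h1 y).deriv, if_pos hf]
  have h2 := Real.sqrt_pos.mpr hf
  have h3 := Real.mul_self_sqrt hf.le
  rw [div_eq_iff h2.ne']
  linear_combination (-1/2 * gd φ y) * h3

lemma xi_sq {φ : ℝ} (h0 : 0 < φ) (h1 : φ < 1) (y : ℝ) :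
    asymNormalXi φ y ^ 2 = (1 / 4 * gd φ y ^ 2) * asymNormalDensity φ y := by
  rw [xi_eq h0 h1, mul_pow, Real.sq_sqrt (f_pos h0 h1 y).le]; ring

lemma gd_sq_le {φ : ℝ} (h0 : 0 < φ) (h1 : φ < 1) (y : ℝ) : gd φ y ^ 2 ≤ 4 * y ^ 2 := by
  have := (g_bounds h0 h1 y).2.2.1
  rw [← sq_abs, ← sq_abs y]
  nlinarith [abs_nonneg (gd φ y)]

lemma partC {φ : ℝ} (h0 : 0 < φ) (h1 : φ < 1) : Integrable (fun y => (asymNormalXi φ y) ^ 2) := by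
  simp only [xi_sq h0 h1]
  have := gd_cont φ
  refine int_of_bound h0 h1 (fun y => 1 / 4 * gd φ y ^ 2) (by fun_prop) 1 fun y => ?_
  have := gd_sq_le h0 h1 y
  rw [abs_of_nonneg (by positivity)]
  nlinarith [sq_nonneg (y ^ 2 - 1)]

lemma partD {φ : ℝ} (h0 : 0 < φ) (h1 : φ < 1) :
    Integrable (fun y => y ^ 2 * (asymNormalXi φ y) ^ 2) := by
  simp only [xi_sq h0 h1, ← mul_assoc]
  have := gd_cont φ
  refine int_of_bound h0 h1 (fun y => y ^ 2 * (1 / 4) * gd φ y ^ 2) (by fun_prop) 1 fun y => ?_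
  have := gd_sq_le h0 h1 y
  rw [abs_of_nonneg (by positivity)]
  nlinarith [sq_nonneg (y ^ 2 - 1), sq_nonneg y]

lemma exp_bound (x : ℝ) : |Real.exp x - 1 - x| ≤ |x| ^ 2 * Real.exp |x| := by
  have := Complex.norm_exp_sub_sum_le_norm_mul_exp (x : ℂ) 2
  simp only [Finset.sum_range_succ, Finset.sum_range_zero, pow_zero, pow_one, Nat.factorial,
    Nat.cast_one, div_one, zero_add, mul_one, Complex.norm_real, Real.norm_eq_abs] at this
  rw [show Complex.exp (x : ℂ) - (1 + (x : ℂ)) = ((Real.exp x - 1 - x : ℝ) : ℂ) by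
    push_cast; ring, Complex.norm_real, Real.norm_eq_abs] at this
  exact this

/-- log of the ratio of square-root densities -/
noncomputable def u (φ η σ y : ℝ) : ℝ := -(1 / 2) * Real.log σ - g φ (y - η) / (2 * σ ^ 2) + g φ y / 2

noncomputable def lin (φ η τ y : ℝ) : ℝ := η * (1 / 2 * gd φ y) + τ * (g φ y - 1 / 2)

lemma u_lin {φ : ℝ} (h0 : 0 < φ) (h1 : φ < 1) (η τ δ y : ℝ) (hδ : δ ≤ 1 / 2) (hη : |η| ≤ δ)
    (hτ : |τ| ≤ δ) : |u φ η (1 + τ) y - lin φ η τ y| ≤ 20 * δ ^ 2 * (1 + y ^ 2) := by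
  have hδ0 : 0 ≤ δ := (abs_nonneg _).trans hη
  obtain ⟨t1, t2⟩ := abs_le.mp hτ
  have hs : 1 / 2 ≤ 1 + τ := by linarith
  have sp : 0 < 1 + τ := by linarith
  obtain ⟨a1, a2, a3, -⟩ := g_bounds h0 h1 y
  have hm : 0 < min φ (1 - φ) := lt_min h0 (by linarith)
  have a0 : 0 ≤ g φ y := le_trans (by positivity) a1
  have q := g_quad h0 h1 y η
  set e := g φ (y - η) - g φ y + η * gd φ y with he
  have hinv : ((1 + τ) ^ 2)⁻¹ ≤ 4 := by
    rw [inv_le_comm₀ (by positivity) (by norm_num)]; nlinarith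
  have hinv0 : 0 < ((1 + τ) ^ 2)⁻¹ := by positivity
  have key : u φ η (1 + τ) y - lin φ η τ y = -(1 / 2) * (Real.log (1 + τ) - τ)
      + g φ y * (τ ^ 2 * ((-3 - 2 * τ) / 2 * ((1 + τ) ^ 2)⁻¹))
      + (η * gd φ y / 2) * (-τ * (2 + τ) * ((1 + τ) ^ 2)⁻¹)
      + -(e / 2 * ((1 + τ) ^ 2)⁻¹) := by
    rw [show g φ (y - η) = e + g φ y - η * gd φ y by rw [he]; ring] at *
    unfold u lin
    rw [show g φ (y - η) = e + g φ y - η * gd φ y by rw [he]; ring]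
    field_simp
    ring
  have τ2 : τ ^ 2 ≤ δ ^ 2 := by rw [← sq_abs]; gcongr
  have η2 : η ^ 2 ≤ δ ^ 2 := by rw [← sq_abs]; gcongr
  have b1 : |-(1 / 2) * (Real.log (1 + τ) - τ)| ≤ δ ^ 2 := by
    have k1 : Real.log (1 + τ) ≤ τ := by linarith [Real.log_le_sub_one_of_pos sp]
    have k2 := Real.one_sub_inv_le_log_of_pos sp
    have k3 : τ - 2 * τ ^ 2 ≤ 1 - (1 + τ)⁻¹ := by
      rw [show 1 - (1 + τ)⁻¹ = τ / (1 + τ) by field_simp; ring, le_div_iff₀ sp]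
      nlinarith [mul_nonneg (sq_nonneg τ) (by linarith : 0 ≤ 1 + 2 * τ)]
    rw [abs_le]; constructor <;> linarith
  have b2 : |g φ y * (τ ^ 2 * ((-3 - 2 * τ) / 2 * ((1 + τ) ^ 2)⁻¹))| ≤ y ^ 2 * (δ ^ 2 * (2 * 4)) := by
    rw [abs_mul, abs_mul, abs_mul, abs_of_nonneg a0, abs_of_nonneg (sq_nonneg τ), abs_of_pos hinv0]
    gcongr
    rw [abs_le]; constructor <;> linarith
  have b3 : |(η * gd φ y / 2) * (-τ * (2 + τ) * ((1 + τ) ^ 2)⁻¹)| ≤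
      (δ * (2 * |y|) / 2) * (δ * (5 / 2) * 4) := by
    rw [abs_mul, abs_mul, abs_mul, abs_div, abs_mul, abs_neg, abs_two, abs_of_pos hinv0]
    gcongr
    rw [abs_le]; constructor <;> linarith
  have b4 : |-(e / 2 * ((1 + τ) ^ 2)⁻¹)| ≤ δ ^ 2 / 2 * 4 := by
    rw [abs_neg, abs_mul, abs_div, abs_two, abs_of_pos hinv0]
    gcongr
    linarith
  rw [key]
  refine (abs_add_le _ _).trans ?_
  have := abs_add_le (-(1 / 2) * (Real.log (1 + τ) - τ)
      + g φ y * (τ ^ 2 * ((-3 - 2 * τ) / 2 * ((1 + τ) ^ 2)⁻¹)))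
      ((η * gd φ y / 2) * (-τ * (2 + τ) * ((1 + τ) ^ 2)⁻¹))
  have := abs_add_le (-(1 / 2) * (Real.log (1 + τ) - τ))
      (g φ y * (τ ^ 2 * ((-3 - 2 * τ) / 2 * ((1 + τ) ^ 2)⁻¹)))
  have h2y : 2 * |y| ≤ 1 + y ^ 2 := by rw [← sq_abs y]; nlinarith [sq_nonneg (|y| - 1)]
  have h2y' := mul_le_mul_of_nonneg_left h2y (sq_nonneg δ)
  have hy2 : 0 ≤ δ ^ 2 * y ^ 2 := by positivity
  have hd2 : 0 ≤ δ ^ 2 := by positivity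
  nlinarith

lemma u_le {φ : ℝ} (h0 : 0 < φ) (h1 : φ < 1) (η τ δ y : ℝ) (hδ : δ ≤ 1 / 2) (hη : |η| ≤ δ)
    (hτ : |τ| ≤ δ) : |u φ η (1 + τ) y| ≤ 20 * δ * (1 + y ^ 2) := by
  have hδ0 : 0 ≤ δ := (abs_nonneg _).trans hη
  have h := u_lin h0 h1 η τ δ y hδ hη hτ
  obtain ⟨a1, a2, a3, -⟩ := g_bounds h0 h1 y
  have hm : 0 < min φ (1 - φ) := lt_min h0 (by linarith)
  have a0 : 0 ≤ g φ y := le_trans (by positivity) a1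
  have h2y : 2 * |y| ≤ 1 + y ^ 2 := by rw [← sq_abs y]; nlinarith [sq_nonneg (|y| - 1)]
  have hl : |lin φ η τ y| ≤ δ * (1 / 2 * (2 * |y|)) + δ * (y ^ 2 + 1 / 2) := by
    unfold lin
    refine (abs_add_le _ _).trans ?_
    rw [abs_mul, abs_mul, abs_mul, abs_of_pos (by norm_num : (0:ℝ) < 1 / 2)]
    gcongr
    rw [abs_le]; constructor <;> linarith
  have h3 : 20 * δ ^ 2 * (1 + y ^ 2) ≤ 10 * δ * (1 + y ^ 2) := by
    exact mul_le_mul_of_nonneg_right (by nlinarith) (by positivity)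
  have h4 : δ * (1 / 2 * (2 * |y|)) + δ * (y ^ 2 + 1 / 2) ≤ 10 * δ * (1 + y ^ 2) := by
    rw [← mul_add, mul_comm 10 δ, mul_assoc]
    gcongr
    nlinarith
  have h5 := abs_add_le (u φ η (1 + τ) y - lin φ η τ y) (lin φ η τ y)
  rw [sub_add_cancel] at h5
  linarith

lemma sqrt_loc {φ : ℝ} (h0 : 0 < φ) (h1 : φ < 1) (η y : ℝ) {σ : ℝ} (hσ : 0 < σ) :
    Real.sqrt (locScale (asymNormalDensity φ) η σ y) =
      Real.sqrt (asymNormalDensity φ y) * Real.exp (u φ η σ y) := by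
  have hf := f_pos h0 h1 y
  have : locScale (asymNormalDensity φ) η σ y = asymNormalDensity φ y * Real.exp (u φ η σ y) ^ 2 := by
    rw [loc_eq φ y η hσ, dens_eq, ← Real.exp_nat_mul]
    nth_rewrite 1 [← Real.exp_log hσ]
    rw [← Real.exp_neg, mul_left_comm, mul_assoc, ← Real.exp_add, ← Real.exp_add]
    unfold u
    congr 2
    push_cast
    field_simp
    ring
  rw [this, Real.sqrt_mul hf.le, Real.sqrt_sq (Real.exp_pos _).le]

lemma R_bound {φ : ℝ} (h0 : 0 < φ) (h1 : φ < 1) (η τ δ y : ℝ) (hδ : δ ≤ min φ (1 - φ) / 160)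
    (hη : |η| ≤ δ) (hτ : |τ| ≤ δ) :
    (Real.sqrt (locScale (asymNormalDensity φ) η (1 + τ) y) - Real.sqrt (asymNormalDensity φ y)
      - η * asymNormalXi φ y - τ * ((g φ y - 1 / 2) * Real.sqrt (asymNormalDensity φ y))) ^ 2
    ≤ δ ^ 4 * (420 ^ 2 * c φ * Real.exp 1 *
      ((1 + y ^ 2) ^ 4 * Real.exp (-(min φ (1 - φ) / 2) * y ^ 2))) := by
  have hm : 0 < min φ (1 - φ) := lt_min h0 (by linarith)
  have hm1 : min φ (1 - φ) ≤ 1 := (min_le_left _ _).trans h1.le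
  have hδ0 : 0 ≤ δ := (abs_nonneg _).trans hη
  have hδ2 : δ ≤ 1 / 2 := by linarith
  have sp : 0 < 1 + τ := by linarith [(abs_le.mp hτ).1]
  have hf := f_pos h0 h1 y
  have A := u_lin h0 h1 η τ δ y hδ2 hη hτ
  have B := u_le h0 h1 η τ δ y hδ2 hη hτ
  have E := exp_bound (u φ η (1 + τ) y)
  rw [sqrt_loc h0 h1 η y sp, xi_eq h0 h1]
  set U := u φ η (1 + τ) y
  set Lx := lin φ η τ y with hLx
  set f := asymNormalDensity φ y with hfdef
  have e1 : Real.sqrt f * Real.exp U - Real.sqrt f - η * (1 / 2 * gd φ y * Real.sqrt f)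
      - τ * ((g φ y - 1 / 2) * Real.sqrt f) = Real.sqrt f * ((Real.exp U - 1 - U) + (U - Lx)) := by
    rw [hLx]; unfold lin; ring
  rw [e1, mul_pow, Real.sq_sqrt hf.le]
  set w := 1 + y ^ 2 with hw
  have w1 : 1 ≤ w := by nlinarith [sq_nonneg y]
  have bd : |(Real.exp U - 1 - U) + (U - Lx)| ≤ 420 * δ ^ 2 * w ^ 2 * Real.exp (20 * δ * w) := by
    refine (abs_add_le _ _).trans ?_
    have c1 : |U| ^ 2 * Real.exp |U| ≤ (20 * δ * w) ^ 2 * Real.exp (20 * δ * w) := by gcongr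
    have c2 : 20 * δ ^ 2 * w ≤ 20 * δ ^ 2 * (w ^ 2 * Real.exp (20 * δ * w)) := by
      have : 1 ≤ Real.exp (20 * δ * w) := Real.one_le_exp (by positivity)
      gcongr
      nlinarith
    calc _ ≤ (20 * δ * w) ^ 2 * Real.exp (20 * δ * w) + 20 * δ ^ 2 * (w ^ 2 * Real.exp (20 * δ * w)) := by
          linarith
      _ = _ := by ring
  have fl := f_le h0 h1 y
  rw [← hfdef] at fl
  have hc := c_pos h0 h1
  have hexp : Real.exp (-min φ (1 - φ) * y ^ 2) * Real.exp (20 * δ * w) ^ 2 ≤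
      Real.exp 1 * Real.exp (-(min φ (1 - φ) / 2) * y ^ 2) := by
    rw [← Real.exp_nat_mul, ← Real.exp_add, ← Real.exp_add]
    apply Real.exp_le_exp.mpr
    push_cast
    have : δ * w ≤ min φ (1 - φ) / 160 * w := by gcongr
    have h3 : 0 ≤ min φ (1 - φ) * y ^ 2 := by positivity
    rw [hw] at this ⊢
    nlinarith
  calc f * ((Real.exp U - 1 - U) + (U - Lx)) ^ 2
      ≤ (c φ * Real.exp (-min φ (1 - φ) * y ^ 2)) *
        (420 * δ ^ 2 * w ^ 2 * Real.exp (20 * δ * w)) ^ 2 := by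
        rw [← sq_abs (_ + _)]; gcongr
    _ = δ ^ 4 * (420 ^ 2 * c φ * w ^ 4 * (Real.exp (-min φ (1 - φ) * y ^ 2) * Real.exp (20 * δ * w) ^ 2)) := by
        ring
    _ ≤ δ ^ 4 * (420 ^ 2 * c φ * w ^ 4 * (Real.exp 1 * Real.exp (-(min φ (1 - φ) / 2) * y ^ 2))) := by
        gcongr
    _ = _ := by ring

lemma int_w {b : ℝ} (hb : 0 < b) : Integrable (fun y : ℝ => (1 + y ^ 2) ^ 4 * Real.exp (-b * y ^ 2)) := by
  have I := int_exp hb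
  have : (fun y : ℝ => (1 + y ^ 2) ^ 4 * Real.exp (-b * y ^ 2)) = fun y : ℝ =>
     y ^ 0 * Real.exp (-b * y ^ 2) + 4 * (y ^ 2 * Real.exp (-b * y ^ 2))
      + 6 * (y ^ 4 * Real.exp (-b * y ^ 2)) + 4 * (y ^ 6 * Real.exp (-b * y ^ 2))
      + y ^ 8 * Real.exp (-b * y ^ 2) := by funext y; ring
  rw [this]
  exact ((((I 0).add ((I 2).const_mul 4)).add ((I 4).const_mul 6)).add ((I 6).const_mul 4)).add (I 8)

lemma partB {φ : ℝ} (h0 : 0 < φ) (h1 : φ < 1) :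
    ∃ ξσ : ℝ → ℝ, Integrable (fun y => (ξσ y) ^ 2) ∧
      (fun θ : ℝ × ℝ => l2norm (fun y =>
          Real.sqrt (locScale (asymNormalDensity φ) θ.1 θ.2 y)
            - Real.sqrt (asymNormalDensity φ y)
            - θ.1 * asymNormalXi φ y - (θ.2 - 1) * ξσ y))
        =o[𝓝 ((0 : ℝ), (1 : ℝ))] (fun θ : ℝ × ℝ => ‖θ - ((0 : ℝ), (1 : ℝ))‖) := by
  have hm : 0 < min φ (1 - φ) := lt_min h0 (by linarith)
  refine ⟨fun y => (g φ y - 1 / 2) * Real.sqrt (asymNormalDensity φ y), ?_, ?_⟩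
  · have e : (fun y => ((g φ y - 1 / 2) * Real.sqrt (asymNormalDensity φ y)) ^ 2) = fun y =>
        (g φ y - 1 / 2) ^ 2 * asymNormalDensity φ y := by
      funext y
      rw [mul_pow, Real.sq_sqrt (f_pos h0 h1 y).le]
    rw [e]
    have := g_cont φ
    refine int_of_bound h0 h1 (fun y => (g φ y - 1 / 2) ^ 2) (by fun_prop) 1 fun y => ?_
    obtain ⟨a1, a2, -, -⟩ := g_bounds h0 h1 y
    have a0 : 0 ≤ g φ y := le_trans (by positivity) a1
    rw [abs_of_nonneg (by positivity)]
    nlinarith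
  · set b : ℝ → ℝ := fun y => 420 ^ 2 * c φ * Real.exp 1 *
      ((1 + y ^ 2) ^ 4 * Real.exp (-(min φ (1 - φ) / 2) * y ^ 2)) with hb
    have ib : Integrable b := (int_w (by positivity)).const_mul _
    have big : (fun θ : ℝ × ℝ => l2norm (fun y =>
          Real.sqrt (locScale (asymNormalDensity φ) θ.1 θ.2 y)
            - Real.sqrt (asymNormalDensity φ y)
            - θ.1 * asymNormalXi φ y
            - (θ.2 - 1) * ((g φ y - 1 / 2) * Real.sqrt (asymNormalDensity φ y))))
        =O[𝓝 ((0 : ℝ), (1 : ℝ))] (fun θ : ℝ × ℝ => ‖θ - ((0 : ℝ), (1 : ℝ))‖ ^ 2) := by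
      apply IsBigO.of_bound (Real.sqrt (∫ y, b y))
      filter_upwards [Metric.ball_mem_nhds ((0 : ℝ), (1 : ℝ)) (by positivity : 0 < min φ (1 - φ) / 160)]
        with θ hθ
      rw [Metric.mem_ball, dist_eq_norm] at hθ
      set δ := ‖θ - ((0 : ℝ), (1 : ℝ))‖ with hδ
      have hη : |θ.1| ≤ δ := by
        have := norm_fst_le (θ - ((0 : ℝ), (1 : ℝ)))
        simpa using this
      have hτ : |θ.2 - 1| ≤ δ := by
        have := norm_snd_le (θ - ((0 : ℝ), (1 : ℝ)))
        simpa using this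
      have hR : ∀ y, _ := fun y => R_bound h0 h1 θ.1 (θ.2 - 1) δ y hθ.le hη hτ
      simp only [add_sub_cancel] at hR
      unfold l2norm
      rw [Real.norm_of_nonneg (Real.sqrt_nonneg _), Real.norm_of_nonneg (by positivity)]
      calc _ ≤ Real.sqrt (∫ y, δ ^ 4 * b y) := by
            apply Real.sqrt_le_sqrt
            refine integral_mono_of_nonneg (Eventually.of_forall fun y => sq_nonneg _) (ib.const_mul _)
              (Eventually.of_forall hR)
        _ = _ := by
            rw [integral_const_mul, show δ ^ 4 = (δ ^ 2) ^ 2 by ring, Real.sqrt_mul (by positivity),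
              Real.sqrt_sq (by positivity), mul_comm]
    refine big.trans_isLittleO ?_
    have hl : Tendsto (fun θ : ℝ × ℝ => ‖θ - ((0 : ℝ), (1 : ℝ))‖) (𝓝 ((0 : ℝ), (1 : ℝ))) (𝓝 0) := by
      have : Continuous (fun θ : ℝ × ℝ => ‖θ - ((0 : ℝ), (1 : ℝ))‖) := by fun_prop
      simpa using this.tendsto ((0 : ℝ), (1 : ℝ))
    have := (isLittleO_pow_pow (𝕜 := ℝ) (m := 1) (n := 2) (by norm_num)).comp_tendsto hl
    simpa [Function.comp_def] using this

end AN

/-- for the asymmetric normal location-scale family: (a) the KL divergence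
`D(f_{0,1}‖f_{η,σ})` is twice differentiable at `(0,1)`, hence `O(η² + (σ-1)²)`; and (b)
the family is Hellinger differentiable at `(0,1)` with location Hellinger derivative
`ξ̇_{(0,1)_η}` satisfying `∫ ξ̇² < ∞` and `∫ y² ξ̇² < ∞`. -/
theorem asym_normal_conditions (φ : ℝ) (hφ0 : 0 < φ) (hφ1 : φ < 1) :
    -- (a) twice differentiability of the KL divergence at (0,1) and the O bound
    ContDiffAt ℝ 2
      (fun θ : ℝ × ℝ =>
        klDiv (asymNormalDensity φ) (locScale (asymNormalDensity φ) θ.1 θ.2))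
      ((0 : ℝ), (1 : ℝ)) ∧
    (fun θ : ℝ × ℝ =>
        klDiv (asymNormalDensity φ) (locScale (asymNormalDensity φ) θ.1 θ.2))
      =O[𝓝 ((0 : ℝ), (1 : ℝ))] (fun θ : ℝ × ℝ => θ.1 ^ 2 + (θ.2 - 1) ^ 2) ∧
    -- (b) Hellinger differentiability at (0,1) with location derivative ξ̇_{(0,1)_η}
    (∃ ξσ : ℝ → ℝ, Integrable (fun y => (ξσ y) ^ 2) ∧
      (fun θ : ℝ × ℝ => l2norm (fun y =>
          Real.sqrt (locScale (asymNormalDensity φ) θ.1 θ.2 y)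
            - Real.sqrt (asymNormalDensity φ y)
            - θ.1 * asymNormalXi φ y - (θ.2 - 1) * ξσ y))
        =o[𝓝 ((0 : ℝ), (1 : ℝ))] (fun θ : ℝ × ℝ => ‖θ - ((0 : ℝ), (1 : ℝ))‖)) ∧
    Integrable (fun y => (asymNormalXi φ y) ^ 2) ∧
    Integrable (fun y => y ^ 2 * (asymNormalXi φ y) ^ 2) := by
  exact ⟨AN.partA hφ0 hφ1, AN.partA2 hφ0 hφ1, AN.partB hφ0 hφ1, AN.partC hφ0 hφ1, AN.partD hφ0 hφ1⟩
end
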